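/- For every real u > 0 and every real z ≥ 0, the lower incomplete Gamma function admits the power-series expansion γ(u, z) = ∫₀^z t^{u-1} e^{-t} dt = ∑_{k=0}^∞ (-1)^k z^{u+k} / (k! (u + k)), where the series converges. -/

import Mathlib

open MeasureTheory

/-- The lower incomplete Gamma function `γ(s, z) = ∫₀^z t^(s-1) e^(-t) dt`. -/
noncomputable def lowerGamma (s z : ℝ) : ℝ :=
  ∫ t in (0 : ℝ)..z, t ^ (s - 1) * Real.exp (-t)

/-- Power series expansion of the lower incomplete Gamma function: for `u > 0`
and `z ≥ 0`, `γ(u, z) = ∑_{k=0}^∞ (-1)^k z^(u+k) / (k! (u + k))`, the series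
converging. -/
theorem paper_lowerGamma_series (u z : ℝ) (hu : 0 < u) (hz : 0 ≤ z) :
    HasSum (fun k : ℕ =>
        (-1 : ℝ) ^ k * z ^ (u + (k : ℝ)) / ((k.factorial : ℝ) * (u + (k : ℝ))))
      (lowerGamma u z) := by
  have hexp (x : ℝ) : HasSum (fun k : ℕ => x ^ k / (k.factorial : ℝ)) (Real.exp x) := by
    rw [Real.exp_eq_exp_ℝ]
    exact NormedSpace.expSeries_div_hasSum_exp x
  have hint : IntervalIntegrable (fun t : ℝ => t ^ (u - 1)) volume 0 z :=
    intervalIntegral.intervalIntegrable_rpow' (by linarith)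
  have hmain := intervalIntegral.hasSum_integral_of_dominated_convergence
    (μ := volume) (a := 0) (b := z)
    (F := fun (k : ℕ) t => t ^ (u - 1) * ((-t) ^ k / (k.factorial : ℝ)))
    (f := fun t => t ^ (u - 1) * Real.exp (-t))
    (fun k t => t ^ (u - 1) * (z ^ k / (k.factorial : ℝ)))
    (fun k => by
      have : Measurable fun t : ℝ => t ^ (u - 1) * ((-t) ^ k / (k.factorial : ℝ)) := by fun_prop
      exact this.aestronglyMeasurable)
    (fun k => ae_of_all _ fun t ht => by
      rw [Set.uIoc_of_le hz] at ht
      have h0 : 0 ≤ t := ht.1.le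
      rw [norm_mul, norm_div, norm_pow, norm_neg, Real.norm_natCast,
        Real.norm_of_nonneg (Real.rpow_nonneg h0 _), Real.norm_of_nonneg h0]
      gcongr
      exact ht.2)
    (ae_of_all _ fun t _ => (hexp z).summable.mul_left _)
    (by simpa only [tsum_mul_left] using hint.mul_const _)
    (ae_of_all _ fun t _ => (hexp (-t)).mul_left _)
  refine (congrArg (HasSum · (lowerGamma u z)) (funext fun k => ?_)).mpr hmain
  have hk : u + (k : ℝ) ≠ 0 := by positivity
  have heq : ∫ t in (0 : ℝ)..z, t ^ (u - 1) * ((-t) ^ k / (k.factorial : ℝ)) =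
      ∫ t in (0 : ℝ)..z, (-1) ^ k / (k.factorial : ℝ) * t ^ (u + k - 1) := by
    refine intervalIntegral.integral_congr_ae (ae_of_all _ fun t ht => ?_)
    rw [Set.uIoc_of_le hz] at ht
    rw [add_sub_right_comm, Real.rpow_add ht.1, Real.rpow_natCast, neg_pow]
    ring
  have hlt : -1 < u + (k : ℝ) - 1 := by
    have : (0 : ℝ) ≤ k := k.cast_nonneg
    linarith
  rw [heq, intervalIntegral.integral_const_mul, integral_rpow (Or.inl hlt), sub_add_cancel,
    Real.zero_rpow hk, sub_zero, div_mul_div_comm]
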